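/- arXiv:1912.01492 — 3 statements merged into one kernel-verified Lean document; each statement's English description precedes it below -/
import Mathlib

section
/- Let T be a bounded linear operator on a nontrivial complex Hilbert space H, let α, β ≥ 0 with α + β ≥ 1, and let r ≥ 1. Then w²(T|T|^{α+β−1}) ≤ 2^{−2/r} ‖ |T|^{2rα} + |T*|^{2rβ} ‖^{2/r} − (1/4) · inf_{‖x‖=1} ( ⟨|T|^{2α}x, x⟩ − ⟨|T*|^{2β}x, x⟩ )². -/
open scoped InnerProductSpace NNReal

variable {H : Type*} [NormedAddCommGroup H] [InnerProductSpace ℂ H] [CompleteSpace H]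

/-- The numerical radius `w(T) = sup { |⟨Tx, x⟩| : ‖x‖ = 1 }`. -/
noncomputable def numRadius (T : H →L[ℂ] H) : ℝ :=
  ⨆ x : {x : H // ‖x‖ = 1}, ‖⟪T x.1, x.1⟫_ℂ‖

/-- The absolute value `|T| = (T*T)^(1/2)`. -/
noncomputable def opAbs (T : H →L[ℂ] H) : H →L[ℂ] H :=
  CFC.sqrt (star T * T)

/-- The real power `|T|^s` of the absolute value, via the continuous functional calculus. -/
noncomputable def opAbsPow (T : H →L[ℂ] H) (s : ℝ) : H →L[ℂ] H :=
  CFC.rpow (opAbs T) s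

theorem mul_cfc_eq_cfc_mul_of_intertwining {T A B : H →L[ℂ] H} (hA : IsSelfAdjoint A)
    (hB : IsSelfAdjoint B) (h : T * A = B * T) {f : ℝ → ℝ} (hf : Continuous f) :
    T * cfc f A = cfc f B * T := by
  have hpoly (p : Polynomial ℝ) : T * Polynomial.aeval A p = Polynomial.aeval B p * T := by
    induction p using Polynomial.induction_on' with
    | add p q hp hq => simp [mul_add, add_mul, hp, hq]
    | monomial n a =>
      have hpow : T * A ^ n = B ^ n * T := (SemiconjBy.pow_right (show SemiconjBy T A B from h) n)
      simp [Polynomial.aeval_monomial, Algebra.algebraMap_eq_smul_one, hpow]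
  rw [← sub_eq_zero, ← norm_le_zero_iff]
  refine le_of_forall_pos_le_add fun ε hε ↦ ?_
  set M : ℝ := max (‖A‖ * ‖(1 : H →L[ℂ] H)‖) (‖B‖ * ‖(1 : H →L[ℂ] H)‖)
  set δ : ℝ := ε / (2 * (‖T‖ + 1))
  have hT : 0 ≤ ‖T‖ := norm_nonneg T
  have hδ : 0 < δ := by positivity
  obtain ⟨p, hp⟩ := exists_polynomial_near_of_continuousOn (-M) M f hf.continuousOn δ hδ
  have hnear {C : H →L[ℂ] H} (hC : IsSelfAdjoint C) (hCM : ‖C‖ * ‖(1 : H →L[ℂ] H)‖ ≤ M) :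
      ‖Polynomial.aeval C p - cfc f C‖ ≤ δ := by
    rw [← cfc_polynomial p C hC, ← cfc_sub _ _ C]
    refine norm_cfc_le hδ.le fun x hx ↦ (hp x ?_).le
    have := spectrum.subset_closedBall_norm_mul C hx
    rw [mem_closedBall_zero_iff, Real.norm_eq_abs] at this
    exact abs_le.mp (this.trans hCM)
  have hAδ := hnear hA (le_max_left _ _)
  have hBδ := hnear hB (le_max_right _ _)
  have key : T * cfc f A - cfc f B * T =
      (Polynomial.aeval B p - cfc f B) * T - T * (Polynomial.aeval A p - cfc f A) := by
    rw [mul_sub, sub_mul, hpoly]; abel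
  rw [key]
  calc _ ≤ ‖Polynomial.aeval B p - cfc f B‖ * ‖T‖ + ‖T‖ * ‖Polynomial.aeval A p - cfc f A‖ :=
        (norm_sub_le _ _).trans (add_le_add (norm_mul_le _ _) (norm_mul_le _ _))
    _ ≤ δ * ‖T‖ + ‖T‖ * δ := by gcongr
    _ ≤ δ * (2 * (‖T‖ + 1)) := by nlinarith
    _ = 0 + ε := by simp only [δ]; field_simp; ring

theorem opAbs_nonneg (T : H →L[ℂ] H) : 0 ≤ opAbs T := CFC.sqrt_nonneg _

theorem isSelfAdjoint_opAbs (T : H →L[ℂ] H) : IsSelfAdjoint (opAbs T) :=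
  (opAbs_nonneg T).isSelfAdjoint

theorem opAbs_mul_self (T : H →L[ℂ] H) : opAbs T * opAbs T = star T * T :=
  CFC.sqrt_mul_sqrt_self _ (star_mul_self_nonneg T)

theorem opAbsPow_eq_cfc (T : H →L[ℂ] H) (s : ℝ) :
    opAbsPow T s = cfc (fun x : ℝ ↦ x ^ s) (opAbs T) :=
  CFC.rpow_eq_cfc_real (opAbs_nonneg T)

theorem opAbs_eq_cfc (T : H →L[ℂ] H) : opAbs T = cfc Real.sqrt (star T * T) := by
  rw [opAbs, CFC.sqrt_eq_real_sqrt _ (star_mul_self_nonneg T), cfcₙ_eq_cfc]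

theorem mul_opAbs (T : H →L[ℂ] H) : T * opAbs T = opAbs (star T) * T := by
  rw [opAbs_eq_cfc, opAbs_eq_cfc, star_star]
  exact mul_cfc_eq_cfc_mul_of_intertwining (.star_mul_self T) (.mul_star_self T)
    (mul_assoc _ _ _).symm Real.continuous_sqrt

theorem mul_cfc_opAbs (T : H →L[ℂ] H) {f : ℝ → ℝ} (hf : Continuous f) :
    T * cfc f (opAbs T) = cfc f (opAbs (star T)) * T :=
  mul_cfc_eq_cfc_mul_of_intertwining (isSelfAdjoint_opAbs T) (isSelfAdjoint_opAbs _)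
    (mul_opAbs T) hf

theorem opAbs_mul_cfc (T : H →L[ℂ] H) {f : ℝ → ℝ} (hf : Continuous f) :
    opAbs T * cfc f (opAbs T) = cfc (fun s ↦ s * f s) (opAbs T) := by
  rw [cfc_mul (fun s ↦ s) f (opAbs T), cfc_id' ℝ (opAbs T) (isSelfAdjoint_opAbs T)]

theorem inner_cfc_left (A : H →L[ℂ] H) (f : ℝ → ℝ) (x y : H) :
    ⟪cfc f A x, y⟫_ℂ = ⟪x, cfc f A y⟫_ℂ := by
  have h : IsSelfAdjoint (cfc f A) := cfc_predicate f A
  rw [← ContinuousLinearMap.adjoint_inner_right, ← ContinuousLinearMap.star_eq_adjoint, h.star_eq]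

theorem norm_opAbs_apply (T : H →L[ℂ] H) (x : H) : ‖opAbs T x‖ = ‖T x‖ := by
  refine (sq_eq_sq₀ (norm_nonneg _) (norm_nonneg _)).mp ?_
  rw [ContinuousLinearMap.apply_norm_sq_eq_inner_adjoint_left,
    ContinuousLinearMap.apply_norm_sq_eq_inner_adjoint_left,
    ← ContinuousLinearMap.star_eq_adjoint, ← ContinuousLinearMap.star_eq_adjoint,
    (isSelfAdjoint_opAbs T).star_eq]
  exact congrArg (fun S : H →L[ℂ] H ↦ RCLike.re ⟪S x, x⟫_ℂ) (opAbs_mul_self T)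

theorem norm_cfc_apply_sq (A : H →L[ℂ] H) {f : ℝ → ℝ} (hf : Continuous f) (x : H) :
    ‖cfc f A x‖ ^ 2 = (⟪cfc (fun s ↦ f s * f s) A x, x⟫_ℂ).re := by
  rw [cfc_mul f f A, mul_apply_eq_comp, inner_cfc_left]
  exact (inner_self_eq_norm_sq (𝕜 := ℂ) _).symm

theorem re_inner_cfc_mono {A : H →L[ℂ] H} (hA : 0 ≤ A) {f g : ℝ → ℝ} (hf : Continuous f)
    (hg : Continuous g) (h : ∀ s, 0 ≤ s → f s ≤ g s) (x : H) :
    (⟪cfc f A x, x⟫_ℂ).re ≤ (⟪cfc g A x, x⟫_ℂ).re := by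
  have hle : cfc f A ≤ cfc g A := cfc_mono fun s hs ↦ h s (spectrum_nonneg_of_nonneg hA hs)
  have := ((ContinuousLinearMap.le_def _ _).mp hle).re_inner_nonneg_left x
  simpa [inner_sub_left] using this

theorem norm_opAbsPow_apply_sq (T : H →L[ℂ] H) {s : ℝ} (hs : 0 ≤ s) (x : H) :
    ‖opAbsPow T s x‖ ^ 2 = (⟪opAbsPow T (2 * s) x, x⟫_ℂ).re := by
  have hc := Real.continuous_rpow_const hs
  have hc' := Real.continuous_rpow_const (show 0 ≤ 2 * s by positivity)
  have heq (t : ℝ) (ht : 0 ≤ t) : t ^ s * t ^ s = t ^ (2 * s) := by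
    rw [two_mul, Real.rpow_add_of_nonneg ht hs hs]
  rw [opAbsPow_eq_cfc, opAbsPow_eq_cfc, norm_cfc_apply_sq _ hc]
  exact le_antisymm
    (re_inner_cfc_mono (opAbs_nonneg T) (hc.mul hc) hc' (fun t ht ↦ (heq t ht).le) x)
    (re_inner_cfc_mono (opAbs_nonneg T) hc' (hc.mul hc) (fun t ht ↦ (heq t ht).ge) x)

/-- A continuous regularization `k` of `s ↦ s ^ (β - 1)` on `[0, ∞)`. -/
theorem exists_continuous_rpow_sub_one_approx {α β : ℝ} (hα : 0 ≤ α) (hβ : 0 ≤ β)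
    (hαβ : 1 ≤ α + β) {ε : ℝ} (hε : 0 < ε) :
    ∃ k : ℝ → ℝ, Continuous k ∧ (∀ s, 0 ≤ s → 0 ≤ s * k s ∧ s * k s ≤ s ^ β) ∧
      ∀ s, 0 ≤ s → |s * (s ^ (α + β - 1) - s ^ α * k s)| ≤ ε := by
  rcases le_total 1 β with h1 | h1
  · refine ⟨fun s ↦ s ^ (β - 1), Real.continuous_rpow_const (by linarith), fun s hs ↦ ?_,
      fun s hs ↦ ?_⟩
    · refine ⟨by positivity, le_of_eq ?_⟩
      rw [← Real.rpow_one_add' hs (by linarith)]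
      congr 1; ring
    · rw [← Real.rpow_add_of_nonneg hs hα (by linarith), add_sub_assoc]
      simpa using hε.le
  · set δ : ℝ := min ε 1
    have hδ : 0 < δ := by positivity
    have hδε : δ ≤ ε := min_le_left _ _
    have hδ1 : δ ≤ 1 := min_le_right _ _
    have hmax (s : ℝ) : 0 < max s δ := lt_max_of_lt_right hδ
    have hle (s : ℝ) (hs : 0 ≤ s) : s * max s δ ^ (β - 1) ≤ s ^ β := by
      rcases hs.eq_or_lt with rfl | hs'
      · simpa using Real.rpow_nonneg le_rfl β
      · calc s * max s δ ^ (β - 1) ≤ s * s ^ (β - 1) := by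
              exact mul_le_mul_of_nonneg_left
                (Real.rpow_le_rpow_of_nonpos hs' (le_max_left _ _) (by linarith)) hs
          _ = s ^ β := by rw [mul_comm, ← Real.rpow_add_one hs'.ne', sub_add_cancel]
    refine ⟨fun s ↦ max s δ ^ (β - 1), ?_, fun s hs ↦ ⟨?_, hle s hs⟩, fun s hs ↦ ?_⟩
    · exact (continuous_id.max continuous_const).rpow_const fun s ↦ .inl (hmax s).ne'
    · have := hmax s
      positivity
    · have h2 : s * s ^ (α + β - 1) = s ^ (α + β) := by
        rw [← Real.rpow_one_add' hs (by linarith)]; congr 1; ring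
      have h3 : s * (s ^ α * max s δ ^ (β - 1)) ≤ s ^ (α + β) := by
        rw [Real.rpow_add_of_nonneg hs hα hβ, mul_left_comm]
        exact mul_le_mul_of_nonneg_left (hle s hs) (by positivity)
      have h4 : 0 ≤ s * (s ^ α * max s δ ^ (β - 1)) := by
        have := hmax s
        positivity
      dsimp only
      rw [mul_sub, h2, abs_of_nonneg (by linarith)]
      rcases le_total s δ with hsδ | hsδ
      · have : s ^ (α + β) ≤ s ^ (1 : ℝ) :=
          Real.rpow_le_rpow_of_exponent_ge' hs (by linarith) zero_le_one hαβ
        rw [Real.rpow_one] at this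
        linarith
      · have hs' : 0 < s := hδ.trans_le hsδ
        rw [max_eq_left hsδ, ← Real.rpow_add hs', ← h2, add_sub_assoc, sub_self]
        exact hε.le

/-- Furuta's mixed Schwarz inequality. -/
theorem norm_inner_mul_opAbsPow_le (T : H →L[ℂ] H) {α β : ℝ} (hα : 0 ≤ α) (hβ : 0 ≤ β)
    (hαβ : 1 ≤ α + β) (x y : H) :
    ‖⟪(T * opAbsPow T (α + β - 1)) x, y⟫_ℂ‖ ≤ ‖opAbsPow T α x‖ * ‖opAbsPow (star T) β y‖ := by
  suffices h : ∀ ε > 0, ‖⟪(T * opAbsPow T (α + β - 1)) x, y⟫_ℂ‖ ≤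
      ‖opAbsPow T α x‖ * ‖opAbsPow (star T) β y‖ + ε * (‖x‖ * ‖y‖) by
    refine le_of_forall_pos_le_add fun ε hε ↦ (h (ε / (‖x‖ * ‖y‖ + 1)) (by positivity)).trans ?_
    gcongr
    rw [div_mul_eq_mul_div, div_le_iff₀ (by positivity)]
    nlinarith
  intro ε hε
  obtain ⟨k, hk, hkβ, hkε⟩ := exists_continuous_rpow_sub_one_approx hα hβ hαβ hε
  have hcα := Real.continuous_rpow_const hα
  have hcβ := Real.continuous_rpow_const hβ
  have hcγ := Real.continuous_rpow_const (show 0 ≤ α + β - 1 by linarith)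
  set P := opAbs T
  set Q := opAbs (star T)
  set D : H →L[ℂ] H := cfc (fun s : ℝ ↦ s ^ (α + β - 1) - s ^ α * k s) P with hD
  have hsplit : T * opAbsPow T (α + β - 1) = T * D + cfc k Q * T * opAbsPow T α := by
    rw [← mul_cfc_opAbs T hk, hD,
      cfc_sub (fun s : ℝ ↦ s ^ (α + β - 1)) (fun s ↦ s ^ α * k s) P hcγ.continuousOn
        (hcα.mul hk).continuousOn,
      cfc_mul (fun s : ℝ ↦ s ^ α) k P hcα.continuousOn hk.continuousOn, opAbsPow_eq_cfc, opAbsPow_eq_cfc,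
      mul_assoc, (cfc_commute_cfc k (fun s : ℝ ↦ s ^ α) P).eq, mul_sub]
    abel
  have hDx : ‖T (D x)‖ ≤ ε * ‖x‖ := by
    rw [← norm_opAbs_apply, ← mul_apply_eq_comp]
    refine ContinuousLinearMap.le_of_opNorm_le _ ?_ x
    rw [hD, opAbs_mul_cfc T (f := fun s ↦ s ^ (α + β - 1) - s ^ α * k s) (hcγ.sub (hcα.mul hk))]
    exact norm_cfc_le hε.le fun s hs ↦ hkε s (spectrum_nonneg_of_nonneg (opAbs_nonneg T) hs)
  have hky : ‖star T (cfc k Q y)‖ ≤ ‖opAbsPow (star T) β y‖ := by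
    rw [← norm_opAbs_apply, ← mul_apply_eq_comp, opAbs_mul_cfc _ hk, opAbsPow_eq_cfc]
    refine (sq_le_sq₀ (norm_nonneg _) (norm_nonneg _)).mp ?_
    rw [norm_cfc_apply_sq _ (by fun_prop), norm_cfc_apply_sq _ hcβ]
    refine re_inner_cfc_mono (opAbs_nonneg _) (by fun_prop) (hcβ.mul hcβ) (fun s hs ↦ ?_) y
    obtain ⟨h0, h1⟩ := hkβ s hs
    exact mul_self_le_mul_self h0 h1
  have hmain : ‖⟪(cfc k Q * T * opAbsPow T α) x, y⟫_ℂ‖ ≤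
      ‖opAbsPow T α x‖ * ‖opAbsPow (star T) β y‖ := by
    rw [mul_apply_eq_comp, mul_apply_eq_comp, inner_cfc_left,
      ← ContinuousLinearMap.adjoint_inner_right, ← ContinuousLinearMap.star_eq_adjoint]
    exact (norm_inner_le_norm _ _).trans (by gcongr)
  rw [hsplit, add_apply, inner_add_left]
  calc _ ≤ ‖⟪(T * D) x, y⟫_ℂ‖ + ‖⟪(cfc k Q * T * opAbsPow T α) x, y⟫_ℂ‖ := norm_add_le _ _
    _ ≤ ε * ‖x‖ * ‖y‖ + ‖opAbsPow T α x‖ * ‖opAbsPow (star T) β y‖ := by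
        refine add_le_add ((norm_inner_le_norm _ _).trans ?_) hmain
        exact mul_le_mul_of_nonneg_right hDx (norm_nonneg _)
    _ = _ := by ring

theorem rpow_tangent_le {c t r : ℝ} (hc : 0 < c) (ht : 0 ≤ t) (hr : 1 ≤ r) :
    c ^ r + r * c ^ (r - 1) * (t - c) ≤ t ^ r := by
  have h := one_add_mul_self_le_rpow_one_add (s := t / c - 1) (by
    have : 0 ≤ t / c := by positivity
    linarith) hr
  rw [add_sub_cancel, Real.div_rpow ht hc.le, le_div_iff₀ (by positivity)] at h
  refine le_trans (le_of_eq ?_) h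
  rw [Real.rpow_sub_one hc.ne']
  field_simp

/-- McCarthy's inequality for powers of the absolute value. -/
theorem re_inner_opAbsPow_rpow_le (T : H →L[ℂ] H) {s r : ℝ} (hs : 0 ≤ s) (hr : 1 ≤ r) {x : H}
    (hx : ‖x‖ = 1) :
    (⟪opAbsPow T (2 * s) x, x⟫_ℂ).re ^ r ≤ (⟪opAbsPow T (2 * r * s) x, x⟫_ℂ).re := by
  have hr0 : 0 ≤ r := by linarith
  set c := (⟪opAbsPow T (2 * s) x, x⟫_ℂ).re with hc
  have hc0 : 0 ≤ c := by rw [hc, ← norm_opAbsPow_apply_sq T hs]; positivity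
  rcases hc0.eq_or_lt with h0 | hpos
  · rw [← h0, Real.zero_rpow (by linarith), mul_assoc, ← norm_opAbsPow_apply_sq T (by positivity)]
    positivity
  have hc1 := Real.continuous_rpow_const (show 0 ≤ 2 * s by positivity)
  have hc2 := Real.continuous_rpow_const (show 0 ≤ 2 * r * s by positivity)
  have hmono := re_inner_cfc_mono (opAbs_nonneg T)
    (f := fun t ↦ (c ^ r - r * c ^ (r - 1) * c) + r * c ^ (r - 1) * t ^ (2 * s)) (by fun_prop)
    hc2 (fun t ht ↦ by
      have := rpow_tangent_le hpos (Real.rpow_nonneg ht (2 * s)) hr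
      rw [← Real.rpow_mul ht, show 2 * s * r = 2 * r * s by ring] at this
      linarith) x
  rw [cfc_const_add _ _ (opAbs T) (by fun_prop) (isSelfAdjoint_opAbs T),
    cfc_const_mul _ _ (opAbs T) (by fun_prop), ← opAbsPow_eq_cfc,
    ← opAbsPow_eq_cfc] at hmono
  refine le_of_eq_of_le ?_ hmono
  have hxx : ⟪x, x⟫_ℂ = 1 := by simp [inner_self_eq_norm_sq_to_K, hx]
  rw [add_apply, inner_add_left, Complex.add_re,
    Algebra.algebraMap_eq_smul_one, smul_apply, smul_apply,
    one_apply_eq_self,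
    ← Complex.coe_smul, ← Complex.coe_smul, inner_smul_left, inner_smul_left, hxx,
    Complex.conj_ofReal, Complex.conj_ofReal, Complex.re_ofReal_mul, Complex.re_ofReal_mul, ← hc,
    Complex.one_re]
  ring

theorem stmt1 [Nontrivial H] (T : H →L[ℂ] H) (α β : ℝ) (hα : 0 ≤ α) (hβ : 0 ≤ β)
    (hαβ : 1 ≤ α + β) (r : ℝ) (hr : 1 ≤ r) :
    numRadius (T * opAbsPow T (α + β - 1)) ^ 2 ≤
      (2 : ℝ) ^ (-(2 : ℝ) / r) *
          ‖opAbsPow T (2 * r * α) + opAbsPow (star T) (2 * r * β)‖ ^ ((2 : ℝ) / r) -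
        (1 / 4 : ℝ) *
          ⨅ x : {x : H // ‖x‖ = 1},
            ((⟪(opAbsPow T (2 * α)) x.1, x.1⟫_ℂ).re -
              (⟪(opAbsPow (star T) (2 * β)) x.1, x.1⟫_ℂ).re) ^ 2 := by
  set N := ‖opAbsPow T (2 * r * α) + opAbsPow (star T) (2 * r * β)‖
  set m := ⨅ x : {x : H // ‖x‖ = 1}, ((⟪(opAbsPow T (2 * α)) x.1, x.1⟫_ℂ).re -
    (⟪(opAbsPow (star T) (2 * β)) x.1, x.1⟫_ℂ).re) ^ 2
  have hr0 : 0 < r := by linarith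
  have hN : 0 ≤ N := norm_nonneg _
  have hpow : (2 : ℝ) ^ (-(2 : ℝ) / r) * N ^ ((2 : ℝ) / r) = ((N / 2) ^ r⁻¹) ^ 2 := by
    rw [neg_div, Real.rpow_neg zero_le_two, ← Real.rpow_natCast, ← Real.rpow_mul (by positivity),
      Real.div_rpow hN zero_le_two, Nat.cast_ofNat, inv_mul_eq_div, inv_mul_eq_div]
  rw [hpow]
  have hpt (x : {x : H // ‖x‖ = 1}) :
      ‖⟪(T * opAbsPow T (α + β - 1)) x.1, x.1⟫_ℂ‖ ^ 2 ≤ ((N / 2) ^ r⁻¹) ^ 2 - 1 / 4 * m := by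
    obtain ⟨x, hx⟩ := x
    set a := (⟪opAbsPow T (2 * α) x, x⟫_ℂ).re with ha
    set b := (⟪opAbsPow (star T) (2 * β) x, x⟫_ℂ).re with hb
    have ha0 : 0 ≤ a := by rw [ha, ← norm_opAbsPow_apply_sq T hα]; positivity
    have hb0 : 0 ≤ b := by rw [hb, ← norm_opAbsPow_apply_sq _ hβ]; positivity
    have hm : m ≤ (a - b) ^ 2 :=
      ciInf_le (f := fun x : {x : H // ‖x‖ = 1} ↦ ((⟪(opAbsPow T (2 * α)) x.1, x.1⟫_ℂ).re -
        (⟪(opAbsPow (star T) (2 * β)) x.1, x.1⟫_ℂ).re) ^ 2)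
        ⟨0, by rintro _ ⟨y, rfl⟩; positivity⟩ ⟨x, hx⟩
    have hfuruta : ‖⟪(T * opAbsPow T (α + β - 1)) x, x⟫_ℂ‖ ^ 2 ≤ a * b := by
      rw [ha, hb, ← norm_opAbsPow_apply_sq T hα, ← norm_opAbsPow_apply_sq _ hβ, ← mul_pow]
      exact pow_le_pow_left₀ (norm_nonneg _) (norm_inner_mul_opAbsPow_le T hα hβ hαβ x x) 2
    have hsum : a ^ r + b ^ r ≤ N := by
      refine (add_le_add (re_inner_opAbsPow_rpow_le T hα hr hx)
        (re_inner_opAbsPow_rpow_le (star T) hβ hr hx)).trans ?_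
      rw [← Complex.add_re, ← inner_add_left, ← add_apply]
      refine (Complex.re_le_norm _).trans ((norm_inner_le_norm _ _).trans ?_)
      simpa [hx] using ContinuousLinearMap.le_opNorm
        (opAbsPow T (2 * r * α) + opAbsPow (star T) (2 * r * β)) x
    have hmean : (a + b) / 2 ≤ (N / 2) ^ r⁻¹ := by
      rw [Real.le_rpow_inv_iff_of_pos (by positivity) (by positivity) hr0]
      have := (convexOn_rpow hr).2 ha0 hb0 (by norm_num : (0 : ℝ) ≤ 1 / 2)
        (by norm_num : (0 : ℝ) ≤ 1 / 2) (by norm_num)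
      simp only [smul_eq_mul] at this
      rw [show (a + b) / 2 = 1 / 2 * a + 1 / 2 * b by ring]
      linarith
    have hsq := pow_le_pow_left₀ (by positivity) hmean 2
    nlinarith
  have hne : Nonempty {x : H // ‖x‖ = 1} := by
    obtain ⟨x, hx⟩ := exists_norm_eq H zero_le_one
    exact ⟨⟨x, hx⟩⟩
  have hnonneg : 0 ≤ ((N / 2) ^ r⁻¹) ^ 2 - 1 / 4 * m := (sq_nonneg _).trans (hpt hne.some)
  refine (Real.le_sqrt (Real.iSup_nonneg fun _ ↦ norm_nonneg _) hnonneg).mp ?_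
  exact ciSup_le fun x ↦ Real.le_sqrt_of_sq_le (hpt x)
end

section
/- Let T be a bounded linear operator on a nontrivial complex Hilbert space H and let s ≥ 1. Then w^{2s}(T) ≤ (1/4) ‖ |T|^{s} + |T*|^{s} ‖² − (1/4) · inf_{‖x‖=1} ( ⟨|T|^{s}x, x⟩ − ⟨|T*|^{s}x, x⟩ ). -/
open scoped InnerProductSpace NNReal

variable {H : Type*} [NormedAddCommGroup H] [InnerProductSpace ℂ H] [CompleteSpace H]

theorem mul_eq_mul_of_mul_sq_eq_sq_mul {A : Type*} [CStarAlgebra A] [PartialOrder A]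
    [StarOrderedRing A] {a b t : A} (ha : 0 ≤ a) (hb : 0 ≤ b)
    (h : t * (a * a) = b * b * t) : t * a = b * t := by
  have ha' : star a = a := ha.isSelfAdjoint
  have hb' : star b = b := hb.isSelfAdjoint
  rw [← sub_eq_zero]
  set x := t * a - b * t with hx
  have hbx : b * x = -(x * a) := by
    rw [hx, mul_sub, sub_mul, neg_sub, mul_assoc t a a, h]
    noncomm_ring
  have hneg : star x * x * a = -(star x * b * x) := by
    rw [mul_assoc, mul_assoc, hbx, mul_neg, neg_neg]
  have hpos : 0 ≤ star x * b * x := star_left_conjugate_nonneg hb x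
  have hcomm : Commute (star x * x) a := by
    have h1 : star (star x * x * a) = star x * x * a := by
      rw [hneg, star_neg, hpos.isSelfAdjoint.star_eq]
    simpa [ha', mul_assoc, commute_iff_eq, eq_comm] using h1
  have hzero : star x * x * a = 0 :=
    le_antisymm (by rw [hneg]; exact neg_nonpos.mpr hpos)
      (hcomm.mul_nonneg (star_mul_self_nonneg x) ha)
  have hxa : x * a = 0 := by
    rw [← CStarRing.star_mul_self_eq_zero_iff, star_mul, ha', mul_assoc, ← mul_assoc (star x),
      hzero, mul_zero]
  have hxb : star x * b = 0 := by
    rw [← star_eq_zero, star_mul, star_star, hb', hbx, hxa, neg_zero]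
  have hxx : star x * x = star x * t * a := by
    calc star x * x = star x * (t * a) - star x * b * t := by
          conv_lhs => rw [hx, mul_sub, ← mul_assoc (star x) b t]
      _ = star x * t * a := by rw [hxb, zero_mul, sub_zero, mul_assoc]
  rw [← CStarRing.star_mul_self_eq_zero_iff, ← CStarRing.mul_star_self_eq_zero_iff]
  calc star x * x * star (star x * x) = star x * (t * (a * a)) * (star t * x) := by
        rw [hxx]; simp [ha', mul_assoc]
    _ = 0 := by simp only [h, ← mul_assoc, hxb, zero_mul]

theorem norm_opAbs (T : H →L[ℂ] H) : ‖opAbs T‖ = ‖T‖ := CFC.norm_abs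

theorem ContinuousLinearMap.re_inner_nonneg_of_nonneg {E : Type*} [NormedAddCommGroup E]
    [InnerProductSpace ℂ E] {A : E →L[ℂ] E} (hA : 0 ≤ A) (x : E) :
    0 ≤ (⟪A x, x⟫_ℂ).re :=
  ((ContinuousLinearMap.nonneg_iff_isPositive A).1 hA).re_inner_nonneg_left x

theorem ContinuousLinearMap.norm_inner_sq_le_of_nonneg {A : H →L[ℂ] H} (hA : 0 ≤ A) (x y : H) :
    ‖⟪A x, y⟫_ℂ‖ ^ 2 ≤ (⟪A x, x⟫_ℂ).re * (⟪A y, y⟫_ℂ).re := by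
  set S := CFC.sqrt A
  have hS : ∀ u v, ⟪A u, v⟫_ℂ = ⟪S u, S v⟫_ℂ := fun u v => by
    rw [← CFC.sqrt_mul_sqrt_self A hA]
    exact ((ContinuousLinearMap.nonneg_iff_isPositive S).1
      (CFC.sqrt_nonneg A)).inner_left_eq_inner_right _ _
  have hn : ∀ u, (⟪S u, S u⟫_ℂ).re = ‖S u‖ ^ 2 := fun u => inner_self_eq_norm_sq (𝕜 := ℂ) (S u)
  rw [hS, hS, hS, hn, hn, ← mul_pow]
  gcongr
  exact norm_inner_le_norm _ _

theorem norm_inner_sq_le_opAbs_mul_opAbs_star (T : H →L[ℂ] H) (x y : H) :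
    ‖⟪T x, y⟫_ℂ‖ ^ 2 ≤ (⟪opAbs T x, x⟫_ℂ).re * (⟪opAbs (star T) y, y⟫_ℂ).re := by
  set A := opAbs T with hA
  set B := opAbs (star T) with hB
  have hBpos := (ContinuousLinearMap.nonneg_iff_isPositive B).1 (opAbs_nonneg (star T))
  have hApos := (ContinuousLinearMap.nonneg_iff_isPositive A).1 (opAbs_nonneg T)
  have hAA : ∀ z, A (A z) = star T (T z) := fun z =>
    congrArg (fun S : H →L[ℂ] H => S z) (opAbs_mul_self T)
  have hBB : ∀ z, B (B z) = T (star T z) := fun z => by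
    simpa using congrArg (fun S : H →L[ℂ] H => S z) (opAbs_mul_self (star T))
  have hTA : ∀ z, T (A z) = B (T z) := fun z =>
    congrArg (fun S : H →L[ℂ] H => S z) (mul_opAbs T)
  have hadj : ∀ u v, ⟪star T u, v⟫_ℂ = ⟪u, T v⟫_ℂ := fun u v =>
    ContinuousLinearMap.adjoint_inner_left T v u
  have hrange : ∀ u ∈ closure (Set.range T),
      ‖⟪T x, u⟫_ℂ‖ ^ 2 ≤ (⟪A x, x⟫_ℂ).re * (⟪B u, u⟫_ℂ).re := by
    intro u hu
    refine closure_minimal (t := {u | ‖⟪T x, u⟫_ℂ‖ ^ 2 ≤ (⟪A x, x⟫_ℂ).re * (⟪B u, u⟫_ℂ).re})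
      ?_ (isClosed_le (by fun_prop) ?_) hu
    · rintro _ ⟨z, rfl⟩
      have h1 : ⟪T x, T z⟫_ℂ = ⟪A x, A z⟫_ℂ := by
        rw [← hadj, ← hAA, hApos.inner_left_eq_inner_right]
      have h2 : ⟪B (T z), T z⟫_ℂ = ⟪A (A z), A z⟫_ℂ := by
        rw [← hTA, ← hadj, ← hAA, hApos.inner_left_eq_inner_right]
      rw [Set.mem_ofPred_eq, h1, h2]
      exact ContinuousLinearMap.norm_inner_sq_le_of_nonneg (opAbs_nonneg T) _ _
    · exact continuous_const.mul (Complex.continuous_re.comp (by fun_prop))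
  set K := (LinearMap.range T.toLinearMap).topologicalClosure with hK
  obtain ⟨u, hu, k, hk, rfl⟩ := K.exists_add_mem_mem_orthogonal y
  have hTk : ∀ z, ⟪T z, k⟫_ℂ = 0 := fun z =>
    hk _ (Submodule.le_topologicalClosure _ ⟨z, rfl⟩)
  have hstar : star T k = 0 := by
    rw [← inner_self_eq_zero (𝕜 := ℂ), hadj, ← inner_conj_symm, hTk, map_zero]
  have hBk : B k = 0 := by
    rw [← inner_self_eq_zero (𝕜 := ℂ), ← hBpos.inner_left_eq_inner_right, hBB, hstar]
    simp
  have hBuk : ⟪B u, k⟫_ℂ = 0 := by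
    rw [hBpos.inner_left_eq_inner_right, hBk, inner_zero_right]
  rw [inner_add_right, hTk, add_zero, map_add, hBk, add_zero, inner_add_right, hBuk, add_zero]
  exact hrange u hu

theorem Real.rpow_add_mul_sub_le {a t p : ℝ} (ha : 0 < a) (ht : 0 ≤ t) (hp : 1 ≤ p) :
    a ^ p + p * a ^ (p - 1) * (t - a) ≤ t ^ p := by
  have h := one_add_mul_self_le_rpow_one_add (s := t / a - 1)
    (by have := div_nonneg ht ha.le; linarith) hp
  rw [add_sub_cancel, Real.div_rpow ht ha.le, le_div_iff₀ (Real.rpow_pos_of_pos ha p)] at h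
  refine le_trans (le_of_eq ?_) h
  rw [Real.rpow_sub_one ha.ne']
  field_simp

/-- McCarthy's inequality. -/
theorem ContinuousLinearMap.re_inner_rpow_le {A : H →L[ℂ] H} (hA : 0 ≤ A) {p : ℝ} (hp : 1 ≤ p)
    {x : H} (hx : ‖x‖ = 1) : (⟪A x, x⟫_ℂ).re ^ p ≤ (⟪(A ^ p) x, x⟫_ℂ).re := by
  set a := (⟪A x, x⟫_ℂ).re with ha
  have hxx : ⟪x, x⟫_ℂ = 1 := by rw [inner_self_eq_norm_sq_to_K, hx]; simp
  rcases (re_inner_nonneg_of_nonneg hA x).eq_or_lt with h0 | h0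
  · rw [ha, ← h0, Real.zero_rpow (by linarith)]
    exact re_inner_nonneg_of_nonneg CFC.rpow_nonneg x
  set c := p * a ^ (p - 1) with hc
  have hle : c • A + (a ^ p - c * a) • (1 : H →L[ℂ] H) ≤ A ^ p := by
    have h1 : c • A + (a ^ p - c * a) • (1 : H →L[ℂ] H)
        = cfc (fun t : ℝ => c * t + (a ^ p - c * a)) A := by
      rw [cfc_add_const (a ^ p - c * a) (fun t : ℝ => c * t) A (by fun_prop) hA.isSelfAdjoint,
        cfc_const_mul_id c A hA.isSelfAdjoint, Algebra.algebraMap_eq_smul_one]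
    rw [h1, CFC.rpow_eq_cfc_real hA]
    refine cfc_mono (fun t ht => ?_) (by fun_prop)
      (Real.continuous_rpow_const (by linarith)).continuousOn
    have := Real.rpow_add_mul_sub_le h0 (spectrum_nonneg_of_nonneg hA ht) hp
    rw [← ha, ← hc] at this
    linarith
  have h2 := re_inner_nonneg_of_nonneg (sub_nonneg.2 hle) x
  simp only [sub_apply, add_apply, smul_apply, one_apply_eq_self, inner_sub_left, inner_add_left,
    Complex.sub_re, Complex.add_re, ← Complex.coe_smul, inner_smul_left, hxx, Complex.conj_ofReal,
    Complex.re_ofReal_mul, ← ha, Complex.one_re] at h2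
  linarith

theorem opAbsPow_nonneg (T : H →L[ℂ] H) (s : ℝ) : 0 ≤ opAbsPow T s := CFC.rpow_nonneg

theorem norm_opAbsPow (T : H →L[ℂ] H) {s : ℝ} (hs : 0 < s) : ‖opAbsPow T s‖ = ‖T‖ ^ s := by
  rw [opAbsPow, CFC.rpow_eq_pow, CFC.norm_rpow _ hs (opAbs_nonneg T), norm_opAbs]

theorem norm_inner_rpow_le (T : H →L[ℂ] H) {s : ℝ} (hs : 1 ≤ s) {x : H} (hx : ‖x‖ = 1) :
    ‖⟪T x, x⟫_ℂ‖ ^ s ≤ ‖opAbsPow T s + opAbsPow (star T) s‖ / 2 := by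
  set a := (⟪opAbs T x, x⟫_ℂ).re with ha
  set b := (⟪opAbs (star T) x, x⟫_ℂ).re with hb
  have ha0 : 0 ≤ a := ContinuousLinearMap.re_inner_nonneg_of_nonneg (opAbs_nonneg T) x
  have hb0 : 0 ≤ b := ContinuousLinearMap.re_inner_nonneg_of_nonneg (opAbs_nonneg _) x
  have hA : a ^ s ≤ (⟪opAbsPow T s x, x⟫_ℂ).re :=
    ContinuousLinearMap.re_inner_rpow_le (opAbs_nonneg T) hs hx
  have hB : b ^ s ≤ (⟪opAbsPow (star T) s x, x⟫_ℂ).re :=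
    ContinuousLinearMap.re_inner_rpow_le (opAbs_nonneg (star T)) hs hx
  have hnorm : (⟪opAbsPow T s x, x⟫_ℂ).re + (⟪opAbsPow (star T) s x, x⟫_ℂ).re ≤
      ‖opAbsPow T s + opAbsPow (star T) s‖ := by
    rw [← Complex.add_re, ← inner_add_left, ← add_apply]
    refine (Complex.re_le_norm _).trans ((norm_inner_le_norm _ _).trans ?_)
    simpa [hx] using (opAbsPow T s + opAbsPow (star T) s).le_opNorm x
  have hsq : (‖⟪T x, x⟫_ℂ‖ ^ s) ^ 2 ≤ a ^ s * b ^ s := by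
    rw [← Real.mul_rpow ha0 hb0, ← Real.rpow_mul_natCast (norm_nonneg _), mul_comm,
      Real.rpow_natCast_mul (norm_nonneg _)]
    exact Real.rpow_le_rpow (sq_nonneg _) (norm_inner_sq_le_opAbs_mul_opAbs_star T x x)
      (by linarith)
  have has := Real.rpow_nonneg ha0 s
  have hbs := Real.rpow_nonneg hb0 s
  refine le_trans (b := (a ^ s + b ^ s) / 2) (abs_le_of_sq_le_sq' ?_ (by linarith)).2 (by linarith)
  nlinarith [sq_nonneg (a ^ s - b ^ s)]

theorem iInf_opAbsPow_sub_nonpos [Nontrivial H] (T : H →L[ℂ] H) {s : ℝ} (hs : 0 < s) :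
    ⨅ x : {x : H // ‖x‖ = 1},
      ((⟪(opAbsPow T s) x.1, x.1⟫_ℂ).re - (⟪(opAbsPow (star T) s) x.1, x.1⟫_ℂ).re) ≤ 0 := by
  by_contra! hpos
  set f : {x : H // ‖x‖ = 1} → ℝ := fun x =>
    (⟪(opAbsPow T s) x.1, x.1⟫_ℂ).re - (⟪(opAbsPow (star T) s) x.1, x.1⟫_ℂ).re with hf
  set c := ⨅ x, f x with hc
  set A := opAbsPow T s with hA
  set B := opAbsPow (star T) s with hB
  have hbdd : BddBelow (Set.range f) := by
    by_contra h
    exact hpos.ne' (Real.sInf_of_not_bddBelow h)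
  have hnorm : ‖B‖ = ‖A‖ := by rw [hA, hB, norm_opAbsPow _ hs, norm_opAbsPow _ hs, norm_star]
  have hunit : ∀ x : H, ‖x‖ = 1 → (⟪B x, x⟫_ℂ).re ≤ ‖A‖ - c := fun x hx => by
    have h1 : c ≤ (⟪A x, x⟫_ℂ).re - (⟪B x, x⟫_ℂ).re := ciInf_le hbdd ⟨x, hx⟩
    have h2 : (⟪A x, x⟫_ℂ).re ≤ ‖A‖ := by
      refine (Complex.re_le_norm _).trans ((norm_inner_le_norm _ _).trans ?_)
      simpa [hx] using A.le_opNorm x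
    linarith
  have hB0 : 0 ≤ B := opAbsPow_nonneg _ _
  obtain ⟨e, he⟩ := exists_norm_eq H zero_le_one
  have hr : 0 ≤ ‖A‖ - c :=
    (ContinuousLinearMap.re_inner_nonneg_of_nonneg hB0 e).trans (hunit e he)
  have hle : ‖B‖ ≤ ‖A‖ - c := by
    set S := CFC.sqrt B with hS
    have hSS : ∀ u, (⟪B u, u⟫_ℂ).re = ‖S u‖ ^ 2 := fun u => by
      rw [← inner_self_eq_norm_sq (𝕜 := ℂ) (S u), ← ((ContinuousLinearMap.nonneg_iff_isPositive S).1
        (CFC.sqrt_nonneg B)).inner_left_eq_inner_right]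
      rw [← CFC.sqrt_mul_sqrt_self B hB0]
      rfl
    have hSn : ‖S‖ ≤ √(‖A‖ - c) := by
      refine S.opNorm_le_of_unit_norm (Real.sqrt_nonneg _) fun x hx => ?_
      exact Real.le_sqrt_of_sq_le ((hSS x).symm.trans_le (hunit x hx))
    calc ‖B‖ = ‖S * S‖ := by rw [CFC.sqrt_mul_sqrt_self B hB0]
      _ ≤ ‖S‖ * ‖S‖ := norm_mul_le _ _
      _ ≤ √(‖A‖ - c) * √(‖A‖ - c) := by gcongr
      _ = ‖A‖ - c := Real.mul_self_sqrt hr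
  linarith

theorem numRadius_rpow_le [Nontrivial H] (T : H →L[ℂ] H) {s : ℝ} (hs : 1 ≤ s) :
    numRadius T ^ s ≤ ‖opAbsPow T s + opAbsPow (star T) s‖ / 2 := by
  obtain ⟨e, he⟩ := exists_norm_eq H zero_le_one
  have : Nonempty {x : H // ‖x‖ = 1} := ⟨⟨e, he⟩⟩
  have hs0 : 0 < s := by linarith
  have hw : 0 ≤ numRadius T := Real.iSup_nonneg fun _ => norm_nonneg _
  rw [← Real.le_rpow_inv_iff_of_pos hw (by positivity) hs0]
  refine ciSup_le fun x => ?_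
  rw [Real.le_rpow_inv_iff_of_pos (norm_nonneg _) (by positivity) hs0]
  exact norm_inner_rpow_le T hs x.2

theorem stmt7 [Nontrivial H] (T : H →L[ℂ] H) (s : ℝ) (hs : 1 ≤ s) :
    numRadius T ^ (2 * s) ≤
      (1 / 4 : ℝ) * ‖opAbsPow T s + opAbsPow (star T) s‖ ^ 2 -
        (1 / 4 : ℝ) *
          ⨅ x : {x : H // ‖x‖ = 1},
            ((⟪(opAbsPow T s) x.1, x.1⟫_ℂ).re - (⟪(opAbsPow (star T) s) x.1, x.1⟫_ℂ).re) := by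
  have hw : 0 ≤ numRadius T := Real.iSup_nonneg fun _ => norm_nonneg _
  have hinf := iInf_opAbsPow_sub_nonpos T (zero_lt_one.trans_le hs)
  have hsq : numRadius T ^ (2 * s) ≤ (‖opAbsPow T s + opAbsPow (star T) s‖ / 2) ^ 2 := by
    rw [mul_comm, Real.rpow_mul hw, Real.rpow_two]
    have := Real.rpow_nonneg hw s
    gcongr
    exact numRadius_rpow_le T hs
  linarith
end

section
/- Let T be a bounded linear operator on a nontrivial complex Hilbert space H. Then w²(T) ≤ (1/2) ‖ T*T + TT* ‖ − (1/4) · inf_{‖x‖=1} ( ⟨|T|²x, x⟩ − ⟨|T*|²x, x⟩ ). This refines the upper bound w²(T) ≤ (1/2) ‖ T*T + TT* ‖ of the Kittaneh inequality. -/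
open scoped InnerProductSpace NNReal

variable {H : Type*} [NormedAddCommGroup H] [InnerProductSpace ℂ H] [CompleteSpace H]

open ContinuousLinearMap in
/-- The quadratic form of `|T|²` is `x ↦ ‖Tx‖²`. -/
theorem re_inner_opAbs_sq (T : H →L[ℂ] H) (x : H) :
    (⟪(opAbs T ^ 2) x, x⟫_ℂ).re = ‖T x‖ ^ 2 := by
  have h : opAbs T ^ 2 = star T * T := CFC.sq_sqrt _ (star_mul_self_nonneg T)
  rw [h, ContinuousLinearMap.mul_def, comp_apply, star_eq_adjoint, adjoint_inner_left]
  exact inner_self_eq_norm_sq (𝕜 := ℂ) (T x)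

open ContinuousLinearMap in
/-- The quadratic form of `T*T + TT*` is bounded by its norm. -/
theorem norm_sq_add_norm_star_sq_le (T : H →L[ℂ] H) (x : H) (hx : ‖x‖ = 1) :
    ‖T x‖ ^ 2 + ‖(star T) x‖ ^ 2 ≤ ‖star T * T + T * star T‖ := by
  have h : (⟪(star T * T + T * star T) x, x⟫_ℂ).re = ‖T x‖ ^ 2 + ‖(star T) x‖ ^ 2 := by
    rw [add_apply, inner_add_left, Complex.add_re, ContinuousLinearMap.mul_def,
      ContinuousLinearMap.mul_def, comp_apply, comp_apply, star_eq_adjoint,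
      adjoint_inner_left, ← adjoint_inner_right T (adjoint T x) x]
    exact congrArg₂ (· + ·) (inner_self_eq_norm_sq (𝕜 := ℂ) (T x))
      (inner_self_eq_norm_sq (𝕜 := ℂ) (adjoint T x))
  rw [← h]
  calc (⟪(star T * T + T * star T) x, x⟫_ℂ).re
      ≤ ‖(star T * T + T * star T) x‖ * ‖x‖ :=
        (Complex.re_le_norm _).trans (norm_inner_le_norm _ _)
    _ ≤ ‖star T * T + T * star T‖ := by
        simpa [hx] using (star T * T + T * star T).le_opNorm x

theorem norm_inner_sq_le_norm_sq {E : Type*} [NormedAddCommGroup E] [InnerProductSpace ℂ E]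
    (T : E →L[ℂ] E) (x : E) (hx : ‖x‖ = 1) :
    ‖⟪T x, x⟫_ℂ‖ ^ 2 ≤ ‖T x‖ ^ 2 := by
  have h := norm_inner_le_norm (𝕜 := ℂ) (T x) x
  rw [hx, mul_one] at h
  gcongr

theorem norm_inner_sq_le_norm_star_sq (T : H →L[ℂ] H) (x : H) (hx : ‖x‖ = 1) :
    ‖⟪T x, x⟫_ℂ‖ ^ 2 ≤ ‖(star T) x‖ ^ 2 := by
  rw [← ContinuousLinearMap.adjoint_inner_right, ← ContinuousLinearMap.star_eq_adjoint,
    norm_inner_symm]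
  exact norm_inner_sq_le_norm_sq (star T) x hx

theorem bddBelow_range_norm_sq_sub (T : H →L[ℂ] H) :
    BddBelow (Set.range fun x : {x : H // ‖x‖ = 1} => ‖T x.1‖ ^ 2 - ‖(star T) x.1‖ ^ 2) := by
  refine ⟨-‖star T‖ ^ 2, ?_⟩
  rintro _ ⟨x, rfl⟩
  have h := (star T).le_opNorm x.1
  rw [x.2, mul_one] at h
  have h2 : ‖(star T) x.1‖ ^ 2 ≤ ‖star T‖ ^ 2 := by gcongr
  change -‖star T‖ ^ 2 ≤ ‖T x.1‖ ^ 2 - ‖(star T) x.1‖ ^ 2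
  linarith [sq_nonneg ‖T x.1‖]

theorem stmt9 [Nontrivial H] (T : H →L[ℂ] H) :
    numRadius T ^ 2 ≤
      (1 / 2 : ℝ) * ‖star T * T + T * star T‖ -
        (1 / 4 : ℝ) *
          ⨅ x : {x : H // ‖x‖ = 1},
            ((⟪(opAbs T ^ 2) x.1, x.1⟫_ℂ).re - (⟪(opAbs (star T) ^ 2) x.1, x.1⟫_ℂ).re) := by
  simp only [re_inner_opAbs_sq]
  set C : ℝ := (1 / 2 : ℝ) * ‖star T * T + T * star T‖ -
    (1 / 4 : ℝ) * ⨅ x : {x : H // ‖x‖ = 1}, (‖T x.1‖ ^ 2 - ‖(star T) x.1‖ ^ 2) with hC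
  have key (x : {x : H // ‖x‖ = 1}) : ‖⟪T x.1, x.1⟫_ℂ‖ ^ 2 ≤ C := by
    have h := ciInf_le (bddBelow_range_norm_sq_sub T) x
    linarith [norm_inner_sq_le_norm_sq T x.1 x.2, norm_inner_sq_le_norm_star_sq T x.1 x.2,
      norm_sq_add_norm_star_sq_le T x.1 x.2]
  obtain ⟨u, hu⟩ := exists_norm_eq H zero_le_one
  have hC0 : 0 ≤ C := (sq_nonneg _).trans (key ⟨u, hu⟩)
  have hw : numRadius T ≤ √C :=
    Real.iSup_le (fun x => Real.le_sqrt_of_sq_le (key x)) (Real.sqrt_nonneg C)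
  have hw0 : 0 ≤ numRadius T := Real.iSup_nonneg fun _ => norm_nonneg _
  exact (Real.le_sqrt hw0 hC0).mp hw
end
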